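/- Let C be an [n,k] linear code over a field F with 1 ≤ k ≤ n−1, and let B0 be any subspace of the dual code C^⊥ with dim B0 ≤ n−k (so that the k-th gap g_k(B0) of B0 is defined). Then g_k(C^⊥) ≥ g_k(B0), and consequently the minimum distance of C satisfies d_min(C) ≤ n + 1 − g_k(B0). -/

import Mathlib

open Classical in
/-- The support of a vector: the set of coordinates where it is nonzero. -/
noncomputable def vsupp {F : Type*} [Field F] {n : ℕ} (v : Fin n → F) : Finset (Fin n) :=
  Finset.univ.filter (fun i => v i ≠ 0)

open Classical in
/-- The support of a subspace: the union of the supports of its vectors. -/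
noncomputable def codeSupp {F : Type*} [Field F] {n : ℕ}
    (D : Submodule F (Fin n → F)) : Finset (Fin n) :=
  Finset.univ.filter (fun i => ∃ v ∈ D, v i ≠ 0)

/-- The dual code w.r.t. the standard bilinear form `⟨x,y⟩ = ∑ x i * y i`. -/
def dualCode {F : Type*} [Field F] {n : ℕ} (C : Submodule F (Fin n → F)) :
    Submodule F (Fin n → F) where
  carrier := {w | ∀ v ∈ C, ∑ i, v i * w i = 0}
  zero_mem' := by intro v _; simp
  add_mem' := by
    intro a b ha hb v hv
    have h : ∑ i, v i * (a + b) i = (∑ i, v i * a i) + ∑ i, v i * b i := by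
      simp [mul_add, Finset.sum_add_distrib]
    rw [h, ha v hv, hb v hv, add_zero]
  smul_mem' := by
    intro c a ha v hv
    have h : ∑ i, v i * (c • a) i = c * ∑ i, v i * a i := by
      simp [Finset.mul_sum, mul_left_comm]
    rw [h, ha v hv, mul_zero]

/-- The `i`-th generalized Hamming weight (1-indexed): the minimum support cardinality
of an `i`-dimensional subspace. -/
noncomputable def ghw {F : Type*} [Field F] {n : ℕ} (C : Submodule F (Fin n → F)) (i : ℕ) : ℕ :=
  sInf {s | ∃ D : Submodule F (Fin n → F), D ≤ C ∧ Module.finrank F D = i ∧ (codeSupp D).card = s}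

/-- The set of gaps of a code: elements of `{1,…,n}` that are not generalized Hamming weights. -/
noncomputable def gapSet {F : Type*} [Field F] {n : ℕ} (C : Submodule F (Fin n → F)) : Finset ℕ :=
  (Finset.Icc 1 n) \ ((Finset.Icc 1 (Module.finrank F C)).image (ghw C))

/-- The `i`-th gap of a code (1-indexed), via the increasing enumeration of the gap set. -/
noncomputable def gapNum {F : Type*} [Field F] {n : ℕ} (C : Submodule F (Fin n → F)) (i : ℕ) : ℕ :=
  ((gapSet C).sort (· ≤ ·)).getD (i - 1) 0

/-- The minimum distance of a code: the minimum Hamming weight of a nonzero codeword. -/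
noncomputable def dmin {F : Type*} [Field F] {n : ℕ} (C : Submodule F (Fin n → F)) : ℕ :=
  sInf {w | ∃ v ∈ C, v ≠ 0 ∧ (vsupp v).card = w}

/-- `S` is an `ℓ`-core (`ℓ = S.card`) of `B` if no nonzero codeword of `B`
has its support contained in `S`. -/
def isCore {F : Type*} [Field F] {n : ℕ} (B : Submodule F (Fin n → F)) (S : Finset (Fin n)) : Prop :=
  ∀ v ∈ B, v ≠ 0 → ¬ (vsupp v ⊆ S)

/-- The subspace of the dual code spanned by all its codewords of Hamming weight `≤ r+1`. -/
noncomputable def lowWtSpan {F : Type*} [Field F] {n : ℕ}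
    (C : Submodule F (Fin n → F)) (r : ℕ) : Submodule F (Fin n → F) :=
  Submodule.span F {c | c ∈ dualCode C ∧ (vsupp c).card ≤ r + 1}

/-- `A_i`: the set of local parities covering coordinate `i`, i.e. dual codewords of
Hamming weight at most `r+1` whose support contains `i`. -/
def coveringParities {F : Type*} [Field F] {n : ℕ}
    (C : Submodule F (Fin n → F)) (r : ℕ) (i : Fin n) : Set (Fin n → F) :=
  {c | c ∈ dualCode C ∧ (vsupp c).card ≤ r + 1 ∧ c i ≠ 0}

/-- `C` is locally 2-reconstructible with locality `r`: every `A_i` is nonempty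
and `A_i ≠ A_j` for `i ≠ j`. -/
def Locally2Recon {F : Type*} [Field F] {n : ℕ}
    (C : Submodule F (Fin n → F)) (r : ℕ) : Prop :=
  (∀ i : Fin n, (coveringParities C r i).Nonempty) ∧
  (∀ i j : Fin n, i ≠ j → coveringParities C r i ≠ coveringParities C r j)

theorem mem_dualCode {F : Type*} [Field F] {n : ℕ} {C : Submodule F (Fin n → F)}
    {w : Fin n → F} : w ∈ dualCode C ↔ ∀ v ∈ C, ∑ i, v i * w i = 0 :=
  Iff.rfl

theorem finrank_add_finrank_dualCode {F : Type*} [Field F] {n : ℕ}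
    (C : Submodule F (Fin n → F)) :
    Module.finrank F C + Module.finrank F (dualCode C) = n := by
  have h : dualCode C =
      C.dualAnnihilator.comap (dotProductEquiv F (Fin n)).toLinearMap := by
    ext w
    simp [mem_dualCode, Submodule.mem_dualAnnihilator, dotProduct, mul_comm]
  rw [h, Submodule.comap_equiv_eq_map_symm, LinearEquiv.finrank_map_eq]
  simpa using Subspace.finrank_add_finrank_dualAnnihilator_eq C

/-- The subspace of vectors vanishing outside `S`. -/
def supportedOn (F : Type*) [Field F] {n : ℕ} (S : Finset (Fin n)) :
    Submodule F (Fin n → F) :=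
  LinearMap.ker (LinearMap.funLeft F F (fun i : {i // i ∉ S} => (i : Fin n)))

theorem mem_supportedOn {F : Type*} [Field F] {n : ℕ} {S : Finset (Fin n)} {v : Fin n → F} :
    v ∈ supportedOn F S ↔ ∀ i ∉ S, v i = 0 := by
  simp [supportedOn, LinearMap.mem_ker, funext_iff, LinearMap.funLeft_apply]

theorem card_le_finrank_supportedOn (F : Type*) [Field F] {n : ℕ} (S : Finset (Fin n)) :
    S.card ≤ Module.finrank F (supportedOn F S) := by
  let f := LinearMap.funLeft F F (fun i : {i // i ∉ S} => (i : Fin n))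
  have h1 := LinearMap.finrank_range_add_finrank_ker f
  have h2 : Module.finrank F (LinearMap.range f) ≤ _ := Submodule.finrank_le _
  have h3 : S.card ≤ n := by simpa using S.card_le_univ
  simp only [Module.finrank_fintype_fun_eq_card, Fintype.card_subtype_compl, Fintype.card_coe,
    Fintype.card_fin] at h1 h2
  change _ ≤ Module.finrank F (LinearMap.ker f)
  omega

theorem le_supportedOn_iff {F : Type*} [Field F] {n : ℕ} {D : Submodule F (Fin n → F)}
    {S : Finset (Fin n)} : D ≤ supportedOn F S ↔ codeSupp D ⊆ S := by
  simp only [SetLike.le_def, mem_supportedOn, codeSupp, Finset.mem_filter, Finset.mem_univ,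
    true_and]
  exact ⟨fun h i ⟨v, hv, hi⟩ => by_contra fun hS => hi (h hv i hS),
    fun h v hv i hS => by_contra fun hi => hS (h ⟨v, hv, hi⟩)⟩

theorem codeSupp_mono {F : Type*} [Field F] {n : ℕ} {D E : Submodule F (Fin n → F)}
    (h : D ≤ E) : codeSupp D ⊆ codeSupp E :=
  le_supportedOn_iff.1 (h.trans (le_supportedOn_iff.2 subset_rfl))

theorem exists_submodule_finrank_eq {F V : Type*} [Field F] [AddCommGroup V] [Module F V]
    (D : Submodule F V) {i : ℕ} (hi : i ≤ Module.finrank F D) :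
    ∃ E ≤ D, Module.finrank F E = i := by
  obtain ⟨f, hf⟩ := exists_linearIndependent_of_le_finrank hi
  have hf' : LinearIndependent F (fun j => (f j : V)) := hf.map' D.subtype D.ker_subtype
  refine ⟨Submodule.span F (Set.range fun j => (f j : V)), ?_, ?_⟩
  · rw [Submodule.span_le]
    rintro _ ⟨j, rfl⟩
    exact (f j).2
  · simpa using finrank_span_eq_card hf'

theorem ghw_le_card {F : Type*} [Field F] {n : ℕ} {C D : Submodule F (Fin n → F)}
    {i : ℕ} (hD : D ≤ C) (hi : i ≤ Module.finrank F D) : ghw C i ≤ (codeSupp D).card := by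
  obtain ⟨E, hED, hE⟩ := exists_submodule_finrank_eq D hi
  have h : ghw C i ≤ (codeSupp E).card := Nat.sInf_le ⟨E, hED.trans hD, hE, rfl⟩
  exact h.trans (Finset.card_le_card (codeSupp_mono hED))

theorem exists_card_codeSupp_eq_ghw {F : Type*} [Field F] {n : ℕ}
    (C : Submodule F (Fin n → F)) {i : ℕ} (hi : i ≤ Module.finrank F C) :
    ∃ D ≤ C, Module.finrank F D = i ∧ (codeSupp D).card = ghw C i := by
  obtain ⟨E, hEC, hE⟩ := exists_submodule_finrank_eq C hi
  exact Nat.sInf_mem (s := {s | ∃ D : Submodule F (Fin n → F), D ≤ C ∧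
    Module.finrank F D = i ∧ (codeSupp D).card = s}) ⟨_, E, hEC, hE, rfl⟩

theorem ghw_anti {F : Type*} [Field F] {n : ℕ} {B C : Submodule F (Fin n → F)} (h : B ≤ C)
    {i : ℕ} (hi : i ≤ Module.finrank F B) : ghw C i ≤ ghw B i := by
  obtain ⟨D, hDB, hD, hc⟩ := exists_card_codeSupp_eq_ghw B hi
  exact hc ▸ ghw_le_card (hDB.trans h) hD.ge

theorem ghw_lt_ghw_succ {F : Type*} [Field F] {n : ℕ} (C : Submodule F (Fin n → F)) {i : ℕ}
    (hi : i + 1 ≤ Module.finrank F C) : ghw C i < ghw C (i + 1) := by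
  obtain ⟨D, hDC, hD, hc⟩ := exists_card_codeSupp_eq_ghw C hi
  have hD0 : D ≠ ⊥ := by
    rintro rfl
    simp at hD
  obtain ⟨v, hv, hv0⟩ := D.exists_mem_ne_zero_of_ne_bot hD0
  obtain ⟨j, hj⟩ := Function.ne_iff.1 hv0
  let E := D ⊓ LinearMap.ker (LinearMap.proj (R := F) (φ := fun _ : Fin n => F) j)
  have hE : i ≤ Module.finrank F E := by
    have h1 := Submodule.finrank_sup_add_finrank_inf_eq D
      (LinearMap.ker (LinearMap.proj (R := F) (φ := fun _ : Fin n => F) j))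
    have h2 := LinearMap.finrank_range_add_finrank_ker
      (LinearMap.proj (R := F) (φ := fun _ : Fin n => F) j)
    have h3 := Submodule.finrank_le
      (LinearMap.range (LinearMap.proj (R := F) (φ := fun _ : Fin n => F) j))
    have h4 := Submodule.finrank_le
      (D ⊔ LinearMap.ker (LinearMap.proj (R := F) (φ := fun _ : Fin n => F) j))
    rw [Module.finrank_self] at h3
    change i ≤ Module.finrank F
      (D ⊓ LinearMap.ker (LinearMap.proj (R := F) (φ := fun _ : Fin n => F) j) : Submodule _ _)
    omega
  refine (ghw_le_card (inf_le_left.trans hDC) hE).trans_lt (hc ▸ Finset.card_lt_card ?_)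
  refine (Finset.ssubset_iff_of_subset (codeSupp_mono inf_le_left)).2 ⟨j, ?_, ?_⟩
  · simp only [codeSupp, Finset.mem_filter, Finset.mem_univ, true_and]
    exact ⟨v, hv, hj⟩
  · simp only [codeSupp, Finset.mem_filter, Finset.mem_univ, true_and]
    rintro ⟨w, hw, hwj⟩
    exact hwj hw.2

theorem ghw_strictMonoOn {F : Type*} [Field F] {n : ℕ} (C : Submodule F (Fin n → F)) :
    StrictMonoOn (ghw C) (Set.Iic (Module.finrank F C)) := by
  intro i _ j hj hij
  induction j, hij using Nat.le_induction with
  | base => exact ghw_lt_ghw_succ C hj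
  | succ j hij ih => exact (ih (Nat.le_of_succ_le hj)).trans (ghw_lt_ghw_succ C hj)

theorem ghw_mem_Icc {F : Type*} [Field F] {n : ℕ} (C : Submodule F (Fin n → F)) {i : ℕ}
    (hi : i ∈ Finset.Icc 1 (Module.finrank F C)) : ghw C i ∈ Finset.Icc 1 n := by
  rw [Finset.mem_Icc] at hi ⊢
  refine ⟨Nat.one_le_iff_ne_zero.2
    (Nat.ne_zero_of_lt (ghw_strictMonoOn C (Nat.zero_le _) hi.2 hi.1)), ?_⟩
  obtain ⟨D, -, -, hc⟩ := exists_card_codeSupp_eq_ghw C hi.2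
  simpa [← hc] using (codeSupp D).card_le_univ

theorem gapNum_eq_nth {F : Type*} [Field F] {n : ℕ} (C : Submodule F (Fin n → F)) (i : ℕ) :
    gapNum C i = Nat.nth (· ∈ gapSet C) (i - 1) := by
  have h : (Set.ofPred (· ∈ gapSet C)).Finite := (gapSet C).finite_toSet
  rw [Nat.nth_eq_getD_sort h, gapNum]
  congr 2
  ext
  simp

theorem card_gapSet_ge {F : Type*} [Field F] {n : ℕ} (C : Submodule F (Fin n → F)) :
    n - Module.finrank F C ≤ (gapSet C).card := by
  have h1 := Finset.le_card_sdiff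
    ((Finset.Icc 1 (Module.finrank F C)).image (ghw C)) (Finset.Icc 1 n)
  have h2 := Finset.card_image_le (s := Finset.Icc 1 (Module.finrank F C)) (f := ghw C)
  simp only [Nat.card_Icc, Nat.add_sub_cancel] at h1 h2
  exact (Nat.sub_le_sub_left h2 n).trans h1

theorem count_gapSet_anti {F : Type*} [Field F] {n : ℕ} {B C : Submodule F (Fin n → F)}
    (h : B ≤ C) (l : ℕ) :
    Nat.count (· ∈ gapSet C) l ≤ Nat.count (· ∈ gapSet B) l := by
  have key (D : Submodule F (Fin n → F)) : Nat.count (· ∈ gapSet D) l =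
      (((Finset.Icc 1 n).filter (· < l)) \
        (((Finset.Icc 1 (Module.finrank F D)).filter (ghw D · < l)).image (ghw D))).card := by
    rw [Nat.count_eq_card_filter_range]
    congr 1
    ext x
    simp only [gapSet, Finset.mem_filter, Finset.mem_range, Finset.mem_sdiff, Finset.mem_image]
    grind
  rw [key, key]
  have hsub : ((Finset.Icc 1 (Module.finrank F C)).filter (ghw C · < l)).image (ghw C) ⊆
      (Finset.Icc 1 n).filter (· < l) := by
    intro x hx
    obtain ⟨i, hi, rfl⟩ := Finset.mem_image.1 hx
    rw [Finset.mem_filter] at hi ⊢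
    exact ⟨ghw_mem_Icc C hi.1, hi.2⟩
  have hinj : Set.InjOn (ghw C)
      ((Finset.Icc 1 (Module.finrank F C)).filter (ghw C · < l)) := by
    refine (ghw_strictMonoOn C).injOn.mono fun i hi => ?_
    simp only [Finset.coe_filter, Finset.mem_Icc, Set.mem_ofPred_eq] at hi
    exact hi.1.2
  rw [Finset.card_sdiff_of_subset hsub, Finset.card_image_of_injOn hinj]
  refine le_trans (Nat.sub_le_sub_left (Finset.card_image_le.trans ?_) _)
    (Finset.le_card_sdiff _ _)
  refine Finset.card_le_card fun i hi => ?_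
  simp only [Finset.mem_filter, Finset.mem_Icc] at hi ⊢
  exact ⟨⟨hi.1.1, hi.1.2.trans (Submodule.finrank_mono h)⟩, (ghw_anti h hi.1.2).trans_lt hi.2⟩

theorem gapNum_mono {F : Type*} [Field F] {n k : ℕ} {B C : Submodule F (Fin n → F)}
    (h : B ≤ C) (hk : k - 1 < (gapSet C).card) : gapNum B k ≤ gapNum C k := by
  rw [gapNum_eq_nth, gapNum_eq_nth, ← Nat.lt_succ_iff]
  refine Nat.nth_lt_of_lt_count (lt_of_lt_of_le ?_ (count_gapSet_anti h _))
  rw [Nat.succ_eq_add_one, Nat.count_nth_succ fun hf => by simpa using hk]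
  exact Nat.lt_succ_self _

theorem gapNum_mem {F : Type*} [Field F] {n k : ℕ} {C : Submodule F (Fin n → F)}
    (hk : k - 1 < (gapSet C).card) : gapNum C k ∈ gapSet C := by
  rw [gapNum_eq_nth]
  exact Nat.nth_mem (p := (· ∈ gapSet C)) _ fun hf => by simpa using hk

theorem dmin_le_card_vsupp {F : Type*} [Field F] {n : ℕ} {C : Submodule F (Fin n → F)}
    {v : Fin n → F} (hv : v ∈ C) (hv0 : v ≠ 0) : dmin C ≤ (vsupp v).card :=
  Nat.sInf_le ⟨v, hv, hv0, rfl⟩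

/-- If fewer than `dmin C` coordinates lie outside `S`, then `S` contains an information set
of `C`, so dual codewords supported on `S` satisfy `dim C` independent conditions. -/
theorem finrank_add_finrank_le_card {F : Type*} [Field F] {n : ℕ}
    {C D : Submodule F (Fin n → F)} {S : Finset (Fin n)} (hS : n < dmin C + S.card)
    (hD : D ≤ dualCode C) (hDS : codeSupp D ⊆ S) :
    Module.finrank F C + Module.finrank F D ≤ S.card := by
  have hSc : Sᶜ.card = n - S.card := by simp [Finset.card_compl]
  have hSn : S.card ≤ n := by simpa using S.card_le_univ
  have hinf : C ⊓ supportedOn F Sᶜ = ⊥ := by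
    rw [Submodule.eq_bot_iff]
    rintro v ⟨hv, hvS⟩
    by_contra hv0
    have hle : (vsupp v).card ≤ Sᶜ.card := by
      refine Finset.card_le_card fun i hi => by_contra fun hiS => ?_
      simp only [vsupp, Finset.mem_filter, Finset.mem_univ, true_and] at hi
      exact hi (mem_supportedOn.1 hvS i hiS)
    have := dmin_le_card_vsupp hv hv0
    omega
  have hdual : C ⊔ supportedOn F Sᶜ ≤ dualCode D := by
    refine sup_le (fun v hv w hw => ?_) (fun v hv w hw => ?_)
    · simpa only [mul_comm] using hD hw v hv
    · refine Finset.sum_eq_zero fun i _ => ?_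
      by_cases hi : i ∈ S
      · rw [mem_supportedOn.1 hv i (by simpa using hi), mul_zero]
      · rw [mem_supportedOn.1 (le_supportedOn_iff.2 hDS hw) i hi, zero_mul]
  have h1 := Submodule.finrank_sup_add_finrank_inf_eq C (supportedOn F Sᶜ)
  rw [hinf, finrank_bot] at h1
  have h2 := card_le_finrank_supportedOn F Sᶜ
  have h3 := Submodule.finrank_mono hdual
  have h4 := finrank_add_finrank_dualCode D
  omega

theorem ghw_dualCode_le {F : Type*} [Field F] {n : ℕ} (C : Submodule F (Fin n → F)) {i : ℕ}
    (hi : Module.finrank F C + i ≤ n) : ghw (dualCode C) i ≤ Module.finrank F C + i := by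
  obtain ⟨S, -, hS⟩ := Finset.exists_subset_card_eq
    (s := (Finset.univ : Finset (Fin n))) (n := Module.finrank F C + i) (by simpa using hi)
  rw [← hS]
  refine (ghw_le_card (D := dualCode C ⊓ supportedOn F S) inf_le_left ?_).trans
    (Finset.card_le_card (le_supportedOn_iff.1 inf_le_right))
  have h1 := Submodule.finrank_sup_add_finrank_inf_eq (dualCode C) (supportedOn F S)
  have h2 := card_le_finrank_supportedOn F S
  have h3 := Submodule.finrank_le (dualCode C ⊔ supportedOn F S)
  have h4 := finrank_add_finrank_dualCode C
  rw [Module.finrank_fin_fun] at h3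
  omega

/-- The gaps of the dual code are at most `n + 1 - dmin C`. -/
theorem add_dmin_le_of_mem_gapSet_dualCode {F : Type*} [Field F] {n : ℕ}
    {C : Submodule F (Fin n → F)} {l : ℕ} (hl : l ∈ gapSet (dualCode C)) :
    l + dmin C ≤ n + 1 := by
  by_contra! hlt
  simp only [gapSet, Finset.mem_sdiff, Finset.mem_Icc, Finset.mem_image, not_exists] at hl
  obtain ⟨⟨hl1, hln⟩, hgap⟩ := hl
  have hdim := finrank_add_finrank_dualCode C
  have hle {D : Submodule F (Fin n → F)} (hD : D ≤ dualCode C)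
      (hcard : (codeSupp D).card ≤ l - 1) :
      Module.finrank F C + Module.finrank F D ≤ l - 1 := by
    obtain ⟨S, hDS, -, hS⟩ := Finset.exists_subsuperset_card_eq
      (Finset.subset_univ (codeSupp D)) hcard (by simp; omega)
    rw [← hS]
    exact finrank_add_finrank_le_card (by omega) hD hDS
  have hk : Module.finrank F C ≤ l - 1 := by
    have := hle (D := ⊥) bot_le (by simp [codeSupp])
    omega
  refine hgap (l - Module.finrank F C) ⟨by omega, le_antisymm ?_ ?_⟩
  · exact (ghw_dualCode_le C (by omega)).trans (by omega)
  · by_contra! hlt'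
    obtain ⟨D, hD, hDi, hc⟩ := exists_card_codeSupp_eq_ghw (dualCode C)
      (i := l - Module.finrank F C) (by omega)
    have := hle hD (by omega)
    omega

/-- if `B0` is a subspace of `C^⊥` with `dim B0 ≤ n-k`, then
`g_k(C^⊥) ≥ g_k(B0)` and `d_min(C) ≤ n + 1 - g_k(B0)`. -/
theorem stmt1 {F : Type*} [Field F] {n k : ℕ} (C B0 : Submodule F (Fin n → F))
    (hC : Module.finrank F C = k) (hk1 : 1 ≤ k) (hkn : k ≤ n - 1)
    (hsub : B0 ≤ dualCode C) (hB0 : Module.finrank F B0 ≤ n - k) :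
    gapNum B0 k ≤ gapNum (dualCode C) k ∧
    dmin C ≤ n + 1 - gapNum B0 k := by
  have hdim := finrank_add_finrank_dualCode C
  have hcard := card_gapSet_ge (dualCode C)
  have hk : k - 1 < (gapSet (dualCode C)).card := by omega
  have hmono := gapNum_mono hsub hk
  have hgap := add_dmin_le_of_mem_gapSet_dualCode (gapNum_mem hk)
  exact ⟨hmono, by omega⟩
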